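/- Let H > 0 be a real number with P̄(H) = 0. Then there exists a constant L₂ > 0 such that 1 ≤ ∑_{ω ∈ L_n} c̄_ω^H ≤ L₂ for every integer n ≥ 1. -/

import Mathlib

open Filter

/-- The weight `c_ω` of a word `ω` over the alphabet `{0,1}` (here `false` is the
letter 0 and `true` is the letter 1): the product of `c0` over letters 0 and `c1`
over letters 1. -/
noncomputable def wt (c0 c1 : ℝ) (w : List Bool) : ℝ :=
  (w.map fun b => if b then c1 else c0).prod

/-- All words of length `n` over the alphabet `{0,1}`. -/
def allWords : ℕ → Finset (List Bool)
  | 0 => {[]}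
  | n + 1 => (allWords n).biUnion fun w => {false :: w, true :: w}

/-- Membership in the language of the S-gap shift: every maximal block of 0s lying
strictly between two 1s has length in `S`. -/
def InLang (S : Set ℕ) (w : List Bool) : Prop :=
  ∀ u v : List Bool, ∀ m : ℕ,
    w = u ++ [true] ++ List.replicate m false ++ [true] ++ v → m ∈ S

/-- Membership in the core set `G`: words of the form `0^{s₁}1 0^{s₂}1 ⋯ 0^{s_k}1`
with `k ≥ 1` and every `s_i ∈ S`. -/
def InCore (S : Set ℕ) (w : List Bool) : Prop :=
  ∃ bs : List ℕ, bs ≠ [] ∧ (∀ s ∈ bs, s ∈ S) ∧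
    w = (bs.map fun s => List.replicate s false ++ [true]).flatten

/-- `L_n`: the words of length `n` in the language of the S-gap shift. -/
noncomputable def langWords (S : Set ℕ) (n : ℕ) : Finset (List Bool) :=
  @Finset.filter _ (InLang S) (Classical.decPred _) (allWords n)

/-- `G_n`: the core words of length `n`. -/
noncomputable def coreWords (S : Set ℕ) (n : ℕ) : Finset (List Bool) :=
  @Finset.filter _ (InCore S) (Classical.decPred _) (allWords n)

/-- The restriction of the weight to the words satisfying `Q`, extended by zero. -/
noncomputable def wtOn (Q : List Bool → Prop) (a b : ℝ) (w : List Bool) : ℝ :=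
  open Classical in if Q w then wt a b w else 0

/-- The words `w` for which `1w` lies in the language and ends in the letter 1. -/
def IsReturn (S : Set ℕ) (w : List Bool) : Prop :=
  InLang S (true :: w) ∧ ∃ p, true :: w = p ++ [true]

theorem mem_allWords {n : ℕ} {w : List Bool} : w ∈ allWords n ↔ w.length = n := by
  induction n generalizing w with
  | zero => simp [allWords]
  | succ n ih =>
    cases w with
    | nil => simp [allWords]
    | cons x w => cases x <;> simp [allWords, ih]

theorem sum_allWords_add (m n : ℕ) (f : List Bool → ℝ) :
    ∑ w ∈ allWords (m + n), f w = ∑ u ∈ allWords m, ∑ v ∈ allWords n, f (u ++ v) := by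
  rw [← Finset.sum_product']
  symm
  refine Finset.sum_nbij' (fun p => p.1 ++ p.2) (fun w => (w.take m, w.drop m)) ?_ ?_ ?_ ?_ ?_
  · rintro ⟨u, v⟩ h
    simp only [Finset.mem_product, mem_allWords] at h
    simp [mem_allWords, h.1, h.2]
  · intro w h
    rw [mem_allWords] at h
    simp [mem_allWords, h]
  · rintro ⟨u, v⟩ h
    simp only [Finset.mem_product, mem_allWords] at h
    simp [← h.1]
  · intro w _
    simp
  · intro _ _
    rfl

theorem sum_allWords_zero (f : List Bool → ℝ) : ∑ w ∈ allWords 0, f w = f [] := by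
  simp [allWords]

theorem sum_allWords_one (f : List Bool → ℝ) :
    ∑ w ∈ allWords 1, f w = f [false] + f [true] := by
  simp [allWords]

theorem wt_append (a b : ℝ) (u v : List Bool) : wt a b (u ++ v) = wt a b u * wt a b v := by
  simp [wt]

theorem wt_pos {a b : ℝ} (ha : 0 < a) (hb : 0 < b) (w : List Bool) : 0 < wt a b w := by
  induction w with
  | nil => simp [wt]
  | cons x w ih =>
    have h : wt a b (x :: w) = (if x then b else a) * wt a b w := by simp [wt]
    rw [h]
    split_ifs <;> positivity

theorem wt_rpow {a b : ℝ} (ha : 0 < a) (hb : 0 < b) (t : ℝ) (w : List Bool) :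
    wt a b w ^ t = wt (a ^ t) (b ^ t) w := by
  induction w with
  | nil => simp [wt]
  | cons x w ih =>
    have h (a b : ℝ) : wt a b (x :: w) = (if x then b else a) * wt a b w := by simp [wt]
    rw [h, h, Real.mul_rpow (by split_ifs <;> positivity) (wt_pos ha hb w).le, ih]
    split_ifs <;> rfl

theorem wtOn_nonneg {a b : ℝ} (ha : 0 < a) (hb : 0 < b) (Q : List Bool → Prop)
    (w : List Bool) : 0 ≤ wtOn Q a b w := by
  unfold wtOn
  split_ifs
  exacts [(wt_pos ha hb w).le, le_rfl]

theorem wtOn_append_le {a b : ℝ} (ha : 0 < a) (hb : 0 < b) {Q Q₁ Q₂ : List Bool → Prop}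
    {u v : List Bool} (h : Q (u ++ v) → Q₁ u ∧ Q₂ v) :
    wtOn Q a b (u ++ v) ≤ wtOn Q₁ a b u * wtOn Q₂ a b v := by
  by_cases hQ : Q (u ++ v)
  · simp [wtOn, hQ, h hQ, wt_append]
  · rw [wtOn, if_neg hQ]
    exact mul_nonneg (wtOn_nonneg ha hb _ _) (wtOn_nonneg ha hb _ _)

theorem mul_le_wtOn_append {a b : ℝ} (ha : 0 < a) (hb : 0 < b) {Q : List Bool → Prop}
    {u v : List Bool} (h : Q u → Q v → Q (u ++ v)) :
    wtOn Q a b u * wtOn Q a b v ≤ wtOn Q a b (u ++ v) := by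
  by_cases hu : Q u
  · by_cases hv : Q v
    · simp [wtOn, hu, hv, h hu hv, wt_append]
    · simpa [wtOn, hv] using wtOn_nonneg ha hb Q (u ++ v)
  · simpa [wtOn, hu] using wtOn_nonneg ha hb Q (u ++ v)

theorem wtOn_mono {a b : ℝ} (ha : 0 < a) (hb : 0 < b) {Q Q' : List Bool → Prop}
    {w : List Bool} (h : Q w → Q' w) : wtOn Q a b w ≤ wtOn Q' a b w := by
  by_cases hQ : Q w
  · simp [wtOn, hQ, h hQ]
  · simpa [wtOn, hQ] using wtOn_nonneg ha hb Q' w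

theorem InLang.of_append_left {S : Set ℕ} {u v : List Bool} (h : InLang S (u ++ v)) :
    InLang S u := by
  rintro x y m rfl
  exact h x (y ++ v) m (by simp)

theorem InLang.of_append_right {S : Set ℕ} {u v : List Bool} (h : InLang S (u ++ v)) :
    InLang S v := by
  rintro x y m rfl
  exact h (u ++ x) y m (by simp)

theorem inLang_replicate_false (S : Set ℕ) (n : ℕ) : InLang S (List.replicate n false) := by
  intro u v m h
  have : true ∈ List.replicate n false := by rw [h]; simp
  simp at this

theorem inLang_cons_false {S : Set ℕ} {w : List Bool} :
    InLang S (false :: w) ↔ InLang S w := by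
  refine ⟨fun h => InLang.of_append_right (u := [false]) h, fun h u v m huv => ?_⟩
  cases u with
  | nil => simp at huv
  | cons x u =>
    simp only [List.cons_append, List.cons.injEq] at huv
    exact h u v m huv.2

theorem inLang_cons_true {S : Set ℕ} {w : List Bool} :
    InLang S (true :: w) ↔
      InLang S w ∧ ∀ m v, w = List.replicate m false ++ true :: v → m ∈ S := by
  refine ⟨fun h => ⟨InLang.of_append_right (u := [true]) h, fun m v hw => ?_⟩,
    fun h u v m huv => ?_⟩
  · exact h [] v m (by simp [hw])
  · cases u with
    | nil => exact h.2 m v (by simpa using huv)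
    | cons x u =>
      simp only [List.cons_append, List.cons.injEq] at huv
      exact h.1 u v m huv.2

theorem exists_eq_replicate_append_of_append {p q v : List Bool} {m : ℕ}
    (h : p ++ true :: q = List.replicate m false ++ true :: v) :
    ∃ v', p ++ [true] = List.replicate m false ++ true :: v' := by
  induction p generalizing m with
  | nil =>
    cases m with
    | zero => exact ⟨[], rfl⟩
    | succ m => simp [List.replicate_succ] at h
  | cons x p ih =>
    cases m with
    | zero =>
      simp only [List.cons_append, List.replicate_zero, List.nil_append, List.cons.injEq] at h
      exact ⟨p ++ [true], by simp [h.1]⟩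
    | succ m =>
      simp only [List.cons_append, List.replicate_succ, List.cons.injEq] at h
      obtain ⟨v', hv'⟩ := ih h.2
      exact ⟨v', by simp [List.replicate_succ, h.1, hv']⟩

theorem InLang.glue {S : Set ℕ} {p q : List Bool} (hp : InLang S (p ++ [true]))
    (hq : InLang S (true :: q)) : InLang S (p ++ true :: q) := by
  induction p with
  | nil => exact hq
  | cons x p ih =>
    cases x with
    | false =>
      simp only [List.cons_append, inLang_cons_false] at hp ⊢
      exact ih hp
    | true =>
      simp only [List.cons_append, inLang_cons_true] at hp ⊢
      refine ⟨ih hp.1, fun m v h => ?_⟩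
      obtain ⟨v', hv'⟩ := exists_eq_replicate_append_of_append h
      exact hp.2 m v' hv'

theorem isReturn_nil (S : Set ℕ) : IsReturn S [] := by
  refine ⟨inLang_cons_true.2 ⟨inLang_replicate_false S 0, ?_⟩, [], rfl⟩
  intro m v h
  simp at h

theorem IsReturn.append {S : Set ℕ} {u v : List Bool} (hu : IsReturn S u)
    (hv : IsReturn S v) : IsReturn S (u ++ v) := by
  obtain ⟨hu, p, hp⟩ := hu
  obtain ⟨hv, q, hq⟩ := hv
  have key : true :: (u ++ v) = p ++ true :: v := by
    rw [← List.cons_append, hp]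
    simp
  refine ⟨?_, p ++ q, ?_⟩
  · rw [key]
    exact InLang.glue (hp ▸ hu) hv
  · rw [key, hq]
    simp

theorem one_le_of_le_pow {Z : ℕ → ℝ} (hZ : ∀ n, 0 < Z n)
    (h : Tendsto (fun n : ℕ => (1 / (n : ℝ)) * Real.log (Z n)) atTop (nhds 0))
    {m : ℕ} (hm : 1 ≤ m) {r : ℝ} (hr : 0 < r) (hle : ∀ k, Z (m * k) ≤ r ^ k) : 1 ≤ r := by
  have hm' : (0 : ℝ) < m := by exact_mod_cast hm
  have hlim := h.comp (tendsto_id.const_mul_atTop' (show 0 < m by omega))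
  have : 0 ≤ Real.log r / m := by
    refine le_of_tendsto hlim ?_
    filter_upwards [eventually_ge_atTop 1] with k hk
    have hk' : (0 : ℝ) < k := by exact_mod_cast hk
    have hl := Real.log_le_log (hZ _) (hle k)
    rw [Real.log_pow] at hl
    simp only [Function.comp, id, Nat.cast_mul]
    rw [one_div_mul_eq_div, div_le_div_iff₀ (by positivity) hm']
    nlinarith
  rw [le_div_iff₀ hm', zero_mul] at this
  exact (Real.log_nonneg_iff hr).1 this

theorem le_one_of_pow_le {Z : ℕ → ℝ}
    (h : Tendsto (fun n : ℕ => (1 / (n : ℝ)) * Real.log (Z n)) atTop (nhds 0))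
    {m : ℕ} (hm : 1 ≤ m) {r : ℝ} (hr : 0 ≤ r) (hle : ∀ k, r ^ k ≤ Z (m * k)) : r ≤ 1 := by
  rcases hr.eq_or_lt with rfl | hr
  · exact zero_le_one
  have hpos (k : ℕ) : 0 < Z (m * k) := (pow_pos hr k).trans_le (hle k)
  have h' : Tendsto (fun n : ℕ => (1 / (n : ℝ)) * Real.log ((Z (m * n))⁻¹)) atTop (nhds 0) := by
    have hlim := ((h.comp (tendsto_id.const_mul_atTop' (show 0 < m by omega))).const_mul
      (m : ℝ)).neg
    simp only [mul_zero, neg_zero] at hlim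
    refine hlim.congr fun k => ?_
    have hm' : (m : ℝ) ≠ 0 := by positivity
    simp only [Function.comp, id, Nat.cast_mul, Real.log_inv, one_div, mul_inv]
    field_simp
  have := one_le_of_le_pow (fun k => inv_pos.2 (hpos k)) h' le_rfl (inv_pos.2 hr) fun k => by
    rw [one_mul, inv_pow]
    exact inv_anti₀ (pow_pos hr k) (hle k)
  exact (one_le_inv₀ hr).1 this

/-- The sum of the weights of the words of length `n` satisfying `Q`. -/
noncomputable def partitionSum (Q : List Bool → Prop) (a b : ℝ) (n : ℕ) : ℝ :=
  ∑ w ∈ allWords n, wtOn Q a b w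

theorem partitionSum_nonneg {a b : ℝ} (ha : 0 < a) (hb : 0 < b) (Q : List Bool → Prop)
    (n : ℕ) : 0 ≤ partitionSum Q a b n :=
  Finset.sum_nonneg fun _ _ => wtOn_nonneg ha hb _ _

theorem partitionSum_mono {a b : ℝ} (ha : 0 < a) (hb : 0 < b) {Q Q' : List Bool → Prop}
    (h : ∀ w, Q w → Q' w) (n : ℕ) : partitionSum Q a b n ≤ partitionSum Q' a b n :=
  Finset.sum_le_sum fun w _ => wtOn_mono ha hb (h w)

theorem sum_langWords_rpow {S : Set ℕ} {a b : ℝ} (ha : 0 < a) (hb : 0 < b) (t : ℝ) (n : ℕ) :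
    ∑ ω ∈ langWords S n, wt a b ω ^ t = partitionSum (InLang S) (a ^ t) (b ^ t) n := by
  simp only [langWords, partitionSum, wtOn, Finset.sum_filter, wt_rpow ha hb]

theorem partitionSum_inLang_pos {a b : ℝ} (ha : 0 < a) (hb : 0 < b) (S : Set ℕ) (n : ℕ) :
    0 < partitionSum (InLang S) a b n := by
  refine Finset.sum_pos' (fun _ _ => wtOn_nonneg ha hb _ _)
    ⟨List.replicate n false, by simp [mem_allWords], ?_⟩
  rw [wtOn, if_pos (inLang_replicate_false S n)]
  exact wt_pos ha hb _

theorem partitionSum_inLang_mul_le {a b : ℝ} (ha : 0 < a) (hb : 0 < b) (S : Set ℕ) (m k : ℕ) :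
    partitionSum (InLang S) a b (m * k) ≤ partitionSum (InLang S) a b m ^ k := by
  induction k with
  | zero => simp [partitionSum, allWords, wtOn, wt, show InLang S [] from inLang_replicate_false S 0]
  | succ k ih =>
    refine le_trans ?_ (mul_le_mul_of_nonneg_right ih (partitionSum_nonneg ha hb _ m))
    rw [partitionSum, mul_add_one, sum_allWords_add, partitionSum, partitionSum,
      Finset.sum_mul_sum]
    exact Finset.sum_le_sum fun u _ => Finset.sum_le_sum fun v _ =>
      wtOn_append_le ha hb fun h => ⟨h.of_append_left, h.of_append_right⟩

theorem partitionSum_isReturn_pow_le {a b : ℝ} (ha : 0 < a) (hb : 0 < b) (S : Set ℕ)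
    (m k : ℕ) :
    partitionSum (IsReturn S) a b m ^ k ≤ partitionSum (IsReturn S) a b (m * k) := by
  induction k with
  | zero => simp [partitionSum, allWords, wtOn, wt, isReturn_nil]
  | succ k ih =>
    refine (mul_le_mul_of_nonneg_right ih (partitionSum_nonneg ha hb _ m)).trans ?_
    rw [partitionSum, partitionSum, Finset.sum_mul_sum, partitionSum, mul_add_one,
      sum_allWords_add]
    exact Finset.sum_le_sum fun u _ => Finset.sum_le_sum fun v _ =>
      mul_le_wtOn_append ha hb IsReturn.append

theorem partitionSum_inLang_succ_le {a b : ℝ} (ha : 0 < a) (hb : 0 < b) (S : Set ℕ) (n : ℕ) :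
    partitionSum (InLang S) a b (n + 1) ≤ a * partitionSum (InLang S) a b n +
      b * partitionSum (fun w => InLang S (true :: w)) a b n := by
  rw [partitionSum, add_comm n 1, sum_allWords_add, sum_allWords_one]
  simp only [partitionSum, Finset.mul_sum]
  refine add_le_add (Finset.sum_le_sum fun w _ => ?_) (Finset.sum_le_sum fun w _ => ?_)
  · refine (wtOn_append_le ha hb (Q₁ := fun _ => True) (Q₂ := InLang S)
      fun h => ⟨trivial, h.of_append_right⟩).trans_eq ?_
    simp [wtOn, wt]
  · refine (wtOn_append_le ha hb (Q₁ := fun _ => True) (Q₂ := fun w => InLang S (true :: w))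
      fun h => ⟨trivial, h⟩).trans_eq ?_
    simp [wtOn, wt]

theorem partitionSum_inLang_cons_true_succ_le {a b : ℝ} (ha : 0 < a) (hb : 0 < b)
    (S : Set ℕ) (n : ℕ) :
    partitionSum (fun w => InLang S (true :: w)) a b (n + 1) ≤
      a * partitionSum (fun w => InLang S (true :: w)) a b n +
        partitionSum (IsReturn S) a b (n + 1) := by
  simp only [partitionSum, sum_allWords_add n 1, sum_allWords_one, Finset.mul_sum,
    ← Finset.sum_add_distrib]
  refine Finset.sum_le_sum fun w _ => ?_
  have h₀ : wtOn (fun w => InLang S (true :: w)) a b (w ++ [false]) ≤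
      a * wtOn (fun w => InLang S (true :: w)) a b w := by
    refine (wtOn_append_le ha hb (Q₁ := fun w => InLang S (true :: w)) (Q₂ := fun _ => True)
      fun h => ⟨InLang.of_append_left (v := [false]) h, trivial⟩).trans_eq ?_
    simp [wtOn, wt, mul_comm]
  have h₁ : wtOn (fun w => InLang S (true :: w)) a b (w ++ [true]) ≤
      wtOn (IsReturn S) a b (w ++ [true]) :=
    wtOn_mono ha hb fun h => ⟨h, true :: w, rfl⟩
  have := wtOn_nonneg ha hb (IsReturn S) (w ++ [false])
  linarith

theorem le_div_one_sub_of_succ_le {a K : ℝ} (ha : 0 ≤ a) (ha1 : a < 1) {u : ℕ → ℝ}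
    (h0 : u 0 ≤ K / (1 - a)) (h : ∀ n, u (n + 1) ≤ a * u n + K) (n : ℕ) :
    u n ≤ K / (1 - a) := by
  induction n with
  | zero => exact h0
  | succ n ih =>
    refine (h n).trans ((add_le_add_left (mul_le_mul_of_nonneg_left ih ha) K).trans_eq ?_)
    have : 1 - a ≠ 0 := by linarith
    field_simp
    ring

/-- If H > 0 and P̄(H) = 0, there is L₂ > 0 with
1 ≤ ∑_{ω ∈ L_n} c̄_ω^H ≤ L₂ for every n ≥ 1. -/
theorem stmt4
    (S : Set ℕ) (hS : S.Infinite)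
    (c0 c1 cb0 cb1 : ℝ)
    (hc0 : 0 < c0) (hc0b : c0 ≤ cb0) (hcb0 : cb0 < 1)
    (hc1 : 0 < c1) (hc1b : c1 ≤ cb1) (hcb1 : cb1 < 1)
    (P Pb : ℝ → ℝ)
    (hP : ∀ t : ℝ, Filter.Tendsto
      (fun n : ℕ => (1 / (n : ℝ)) * Real.log (∑ ω ∈ langWords S n, wt c0 c1 ω ^ t))
      Filter.atTop (nhds (P t)))
    (hPb : ∀ t : ℝ, Filter.Tendsto
      (fun n : ℕ => (1 / (n : ℝ)) * Real.log (∑ ω ∈ langWords S n, wt cb0 cb1 ω ^ t))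
      Filter.atTop (nhds (Pb t)))
    (H : ℝ) (hH : 0 < H) (hPH : Pb H = 0) :
    ∃ L₂ : ℝ, 0 < L₂ ∧ ∀ n : ℕ, 1 ≤ n →
      1 ≤ ∑ ω ∈ langWords S n, wt cb0 cb1 ω ^ H ∧
      ∑ ω ∈ langWords S n, wt cb0 cb1 ω ^ H ≤ L₂ := by
  have hcb0' : 0 < cb0 := hc0.trans_le hc0b
  have hcb1' : 0 < cb1 := hc1.trans_le hc1b
  have hlim := hPb H
  simp only [hPH, sum_langWords_rpow hcb0' hcb1'] at hlim ⊢
  have ha : 0 < cb0 ^ H := Real.rpow_pos_of_pos hcb0' H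
  have hb : 0 < cb1 ^ H := Real.rpow_pos_of_pos hcb1' H
  have ha1 : cb0 ^ H < 1 := Real.rpow_lt_one hcb0'.le hcb0 hH
  have hb1 : cb1 ^ H < 1 := Real.rpow_lt_one hcb1'.le hcb1 hH
  generalize cb0 ^ H = a at *
  generalize cb1 ^ H = b at *
  have hret (n : ℕ) : partitionSum (IsReturn S) a b (n + 1) ≤ 1 :=
    le_one_of_pow_le hlim n.succ_pos (partitionSum_nonneg ha hb _ _) fun k =>
      (partitionSum_isReturn_pow_le ha hb S _ k).trans
        (partitionSum_mono ha hb (fun w hw => InLang.of_append_right (u := [true]) hw.1) _)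
  have hone : 1 ≤ 1 / (1 - a) := by
    rw [le_div_iff₀ (by linarith)]
    linarith
  have hzero : ∀ Q : List Bool → Prop, partitionSum Q a b 0 ≤ 1 := by
    intro Q
    rw [partitionSum, sum_allWords_zero, wtOn]
    split_ifs <;> simp [wt]
  have htrue := le_div_one_sub_of_succ_le ha.le ha1 ((hzero _).trans hone) fun n =>
    (partitionSum_inLang_cons_true_succ_le ha hb S n).trans (by linarith [hret n])
  have hbound : ∀ n, partitionSum (InLang S) a b n ≤ 1 / (1 - a) / (1 - a) := by
    refine le_div_one_sub_of_succ_le ha.le ha1 ((hzero _).trans ?_) fun n =>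
      (partitionSum_inLang_succ_le ha hb S n).trans ?_
    · rw [le_div_iff₀ (by linarith)]
      linarith
    · have := mul_le_of_le_one_left
        (partitionSum_nonneg ha hb (fun w => InLang S (true :: w)) n) hb1.le
      linarith [htrue n]
  exact ⟨1 / (1 - a) / (1 - a), (partitionSum_inLang_pos ha hb S 0).trans_le (hbound 0),
    fun n hn => ⟨one_le_of_le_pow (partitionSum_inLang_pos ha hb S) hlim hn
      (partitionSum_inLang_pos ha hb S n) (partitionSum_inLang_mul_le ha hb S n), hbound n⟩⟩
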